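/- In the cohomology ring H^*(Sym^d(Σ),ℤ) with d > 1: for i ≠ j one has η^{d−2}σ_i σ_j = η^{d−1}(σ_i + σ_j) − η^d, and consequently η^{d−2}σ² = g(g−1)η^d. -/

import Mathlib

/-!
STATEMENT 11 (relations (sigisigj) and (2ndstep) of the paper).

Setting: `Σ` is a compact connected Riemann surface of genus `g`,
`Sym^d(Σ) = Σ^d/𝔖_d` with `d > 1`.  In `H^*(Sym^d(Σ),ℤ)` one has
`η = Σᵢ πᵢ^*β`, `ξⱼ = Σₖ πₖ^*αⱼ`, `σⱼ = ξⱼξ_{j+g}` (`j = 1,…,g`) and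
`σ = Σⱼ σⱼ`; in particular `σⱼ² = 0` by anticommutativity of the `ξ`'s.
Macdonald's presentation gives, for `i ≠ j` (relation (nontrrel) with `r = d−2`,
`J = {i,j}`, `I₁ = I₂ = ∅`), `η^{d−2}(η − σᵢ)(η − σⱼ) = 0`, and (with `r = d−1`,
`J = {j}`) `η^{d−1}σⱼ = η^d`.

Abstraction used below: `R` is the (even part of the) commutative cohomology
ring `H^*(Sym^d(Σ),ℤ)`, with elements `η` and `σⱼ` satisfying those relations.

Conclusion: for `i ≠ j`, `η^{d−2}σᵢσⱼ = η^{d−1}(σᵢ + σⱼ) − η^d`, and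
consequently `η^{d−2}σ² = g(g−1)η^d`.
-/

theorem eta_sigma_squared_relation
    (g d : ℕ) (hd : 1 < d)
    (R : Type*) [CommRing R]
    (η : R) (σj : Fin g → R)
    -- `σⱼ² = 0` (anticommutativity of the `ξ`'s)
    (hsq : ∀ j : Fin g, σj j ^ 2 = 0)
    -- relation (sigjeta): `η^{d−1}σⱼ = η^d`
    (hrel1 : ∀ j : Fin g, η ^ (d - 1) * σj j = η ^ d)
    -- relation (nontrrel) with `r = d−2`, `J = {i,j}`, `I₁ = I₂ = ∅`
    (hrel2 : ∀ i j : Fin g, i ≠ j → η ^ (d - 2) * ((η - σj i) * (η - σj j)) = 0) :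
    (∀ i j : Fin g, i ≠ j →
      η ^ (d - 2) * (σj i * σj j) = η ^ (d - 1) * (σj i + σj j) - η ^ d) ∧
    η ^ (d - 2) * (∑ j : Fin g, σj j) ^ 2 = (g : R) * ((g : R) - 1) * η ^ d := by
  obtain ⟨k, rfl⟩ : ∃ k, d = k + 2 := ⟨d - 2, by omega⟩
  simp only [Nat.add_sub_cancel, show k + 2 - 1 = k + 1 by omega] at hrel1 hrel2 ⊢
  have hmul : ∀ i j : Fin g, i ≠ j →
      η ^ k * (σj i * σj j) = η ^ (k + 1) * (σj i + σj j) - η ^ (k + 2) := by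
    intro i j hij
    linear_combination hrel2 i j hij
  refine ⟨hmul, ?_⟩
  have hentry : ∀ i j : Fin g,
      η ^ k * (σj i * σj j) = η ^ (k + 2) - if i = j then η ^ (k + 2) else 0 := by
    intro i j
    split_ifs with hij
    · subst hij
      linear_combination η ^ k * hsq i
    · linear_combination hmul i j hij + hrel1 i + hrel1 j
  rw [sq, Finset.sum_mul_sum]
  simp only [Finset.mul_sum, hentry, Finset.sum_sub_distrib, Finset.sum_const,
    Finset.sum_ite_eq, Finset.mem_univ, if_true, Finset.card_univ, Fintype.card_fin,
    nsmul_eq_mul]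
  ring
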